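/- arXiv:2106.15094 — 3 statements merged into one kernel-verified Lean document; each statement's English description precedes it below -/
import Mathlib

section
/- If Φ and Ψ are two allocations both satisfying axioms A1 (efficiency), A2 (symmetry), A3 (null-player), A4 (linearity), and A5 (reflection), then Φ_i[v] = Ψ_i[v] for every v ∈ 𝒢 and every i ∈ ℕ. -/
open Finset

/-- A cooperative game on `[N]`: a function on coalitions vanishing on the empty coalition. -/
def Game (N : ℕ) := {v : Finset (Fin N) → ℝ // v ∅ = 0}

/-- The linear combination `α v + α' v'` of two games. -/
def gameLC {N : ℕ} (a b : ℝ) (v w : Game N) : Game N :=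
  ⟨fun S => a * v.1 S + b * w.1 S, by simp [v.2, w.2]⟩

/-- The game `v^{ij}`, in which the contributions of players `i` and `j` are interchanged:
`v^{ij}(S) = v(S^{ij})`, where `S^{ij}` is the image of `S` under the transposition of `i,j`. -/
def swapGame {N : ℕ} (i j : Fin N) (v : Game N) : Game N :=
  ⟨fun S => v.1 (S.image (Equiv.swap i j)), by simp [v.2]⟩

/-- The restricted game `v_{-i}` on the player set `[N] \ {i}`, identified with
`Fin n` (where `N = n+1`) via the order-preserving bijection `Fin.succAbove i`. -/
def restrictGame {n : ℕ} (i : Fin (n + 1)) (v : Game (n + 1)) : Game n :=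
  ⟨fun S => v.1 (S.image i.succAbove), by simp [v.2]⟩

/-- The axioms A1--A5 for an allocation `v ∈ 𝒢 ↦ (Φ_i[v])_{i ∈ ℕ}`:
each `Φ_i[v]` is a game in `𝒢_N`, `Φ_i[v] ≡ 0` for players `i` beyond `[N]`, and
A1 (efficiency), A2 (symmetry), A3 (null-player), A4 (linearity), A5 (reflection) hold. -/
def IsHodgeAllocation (Φ : (N : ℕ) → Game N → ℕ → Finset (Fin N) → ℝ) : Prop :=
  -- each Φ_i[v] belongs to 𝒢_N
  (∀ (N : ℕ) (v : Game N) (k : ℕ), Φ N v k ∅ = 0) ∧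
  -- Φ_i[v] ≡ 0 for players beyond [N]
  (∀ (N : ℕ) (v : Game N) (k : ℕ), N ≤ k → ∀ S : Finset (Fin N), Φ N v k S = 0) ∧
  -- A1 (efficiency): v = ∑_i Φ_i[v]
  (∀ (N : ℕ) (v : Game N) (S : Finset (Fin N)), v.1 S = ∑ i : Fin N, Φ N v i.1 S) ∧
  -- A2 (symmetry): Φ_i[v^{ij}](S^{ij}) = Φ_j[v](S)
  (∀ (N : ℕ) (v : Game N) (i j : Fin N) (S : Finset (Fin N)),
    Φ N (swapGame i j v) i.1 (S.image (Equiv.swap i j)) = Φ N v j.1 S) ∧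
  -- A3 (null-player): if d_i v = 0 then Φ_i[v] ≡ 0 and
  -- Φ_j[v](S ∪ {i}) = Φ_j[v](S) = Φ_j[v_{-i}](S) for j ≠ i, S ⊆ [N] \ {i}
  (∀ (n : ℕ) (v : Game (n + 1)) (i : Fin (n + 1)),
    (∀ S : Finset (Fin (n + 1)), i ∉ S → v.1 (insert i S) = v.1 S) →
    (∀ S : Finset (Fin (n + 1)), Φ (n + 1) v i.1 S = 0) ∧
    (∀ (j : Fin n) (S : Finset (Fin n)),
      Φ (n + 1) v (i.succAbove j).1 (insert i (S.image i.succAbove))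
        = Φ (n + 1) v (i.succAbove j).1 (S.image i.succAbove) ∧
      Φ (n + 1) v (i.succAbove j).1 (S.image i.succAbove)
        = Φ n (restrictGame i v) j.1 S)) ∧
  -- A4 (linearity)
  (∀ (N : ℕ) (a b : ℝ) (v w : Game N) (k : ℕ) (S : Finset (Fin N)),
    Φ N (gameLC a b v w) k S = a * Φ N v k S + b * Φ N w k S) ∧
  -- A5 (reflection)
  (∀ (N : ℕ) (v : Game N) (i : Fin N) (S T : Finset (Fin N)), i ∉ S → i ∉ T →
    Φ N v i.1 (insert i S) - Φ N v i.1 (insert i T) = -(Φ N v i.1 S - Φ N v i.1 T))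

section Symmetric

variable {ι : Type*} [Fintype ι] [DecidableEq ι] {d : ι → Finset ι → ℝ} {c : ℝ}

/-- A nonnegative value at singletons propagates to all coalitions: members receive at least
`c`, and outsiders receive at most `0`. -/
lemma symmetric_allocation_bounds (hc : 0 ≤ c)
    (hsum : ∀ S, ∑ i, d i S = 0)
    (hsymm : ∀ i j S, d i (S.image (Equiv.swap i j)) = d j S)
    (hrefl : ∀ i S, i ∉ S → d i (insert i S) = c - d i S) (S : Finset ι) :
    (∀ i ∈ S, c ≤ d i S) ∧ ∀ i ∉ S, d i S ≤ 0 := by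
  induction S using Finset.strongInduction with
  | H S ih =>
    have hmem : ∀ i ∈ S, c ≤ d i S := by
      intro i hi
      have h := hrefl i (S.erase i) (notMem_erase i S)
      rw [insert_erase hi] at h
      have := (ih _ (erase_ssubset hi)).2 i (notMem_erase i S)
      linarith
    refine ⟨hmem, fun i hi => ?_⟩
    have heq : ∀ j ∈ Sᶜ, d j S = d i S := by
      intro j hj
      have hj : j ∉ S := by simpa using hj
      have himage : S.image (Equiv.swap j i) = S := by
        conv_rhs => rw [← image_id (s := S)]
        refine image_congr fun k hk => ?_
        exact Equiv.swap_apply_of_ne_of_ne (fun h => hj (h ▸ hk)) (fun h => hi (h ▸ hk))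
      rw [← hsymm j i S, himage]
    have htotal := hsum S
    rw [← sum_add_sum_compl S, sum_congr rfl heq, sum_const, nsmul_eq_mul] at htotal
    have hnonneg : 0 ≤ ∑ j ∈ S, d j S := sum_nonneg fun j hj => hc.trans (hmem j hj)
    have hcard : (0 : ℝ) < #Sᶜ := by
      exact_mod_cast card_pos.2 ⟨i, by simpa using hi⟩
    by_contra! hpos
    linarith [mul_pos hcard hpos]

lemma symmetric_allocation_const_nonpos [Nonempty ι]
    (hsum : ∀ S, ∑ i, d i S = 0)
    (hsymm : ∀ i j S, d i (S.image (Equiv.swap i j)) = d j S)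
    (hrefl : ∀ i S, i ∉ S → d i (insert i S) = c - d i S) : c ≤ 0 := by
  by_contra! hc
  have hpos : 0 < ∑ i, d i univ := sum_pos
    (fun i hi => hc.trans_le ((symmetric_allocation_bounds hc.le hsum hsymm hrefl univ).1 i hi))
    univ_nonempty
  exact hpos.ne' (hsum univ)

lemma symmetric_allocation_eq_zero
    (hsum : ∀ S, ∑ i, d i S = 0)
    (hsymm : ∀ i j S, d i (S.image (Equiv.swap i j)) = d j S)
    (hrefl : ∀ i S, i ∉ S → d i (insert i S) = d i {i} - d i S) (i : ι) (S : Finset ι) :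
    d i S = 0 := by
  have : Nonempty ι := ⟨i⟩
  have hrefl' : ∀ j T, j ∉ T → d j (insert j T) = d i {i} - d j T := by
    intro j T hj
    rw [hrefl j T hj, ← hsymm i j {j}]
    simp
  have hsum_neg : ∀ T, ∑ j, -d j T = 0 := fun T => by rw [sum_neg_distrib, hsum, neg_zero]
  have hsymm_neg : ∀ j k T, -d j (T.image (Equiv.swap j k)) = -d k T :=
    fun j k T => by rw [hsymm]
  have hrefl_neg : ∀ j T, j ∉ T → -d j (insert j T) = -d i {i} - -d j T :=
    fun j T hj => by rw [hrefl' j T hj]; ring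
  have hle := symmetric_allocation_const_nonpos hsum hsymm hrefl'
  have hge := symmetric_allocation_const_nonpos (d := fun j T => -d j T)
    hsum_neg hsymm_neg hrefl_neg
  have hb := symmetric_allocation_bounds (by linarith) hsum hsymm hrefl' S
  have hb_neg := symmetric_allocation_bounds (d := fun j T => -d j T) (by linarith)
    hsum_neg hsymm_neg hrefl_neg S
  by_cases hi : i ∈ S
  · linarith [hb.1 i hi, hb_neg.1 i hi]
  · linarith [hb.2 i hi, hb_neg.2 i hi]

end Symmetric

/-- The game in which player `i` is made null by ignoring its presence. -/
def eraseGame {N : ℕ} (i : Fin N) (v : Game N) : Game N :=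
  ⟨fun S => v.1 (S.erase i), by simp [v.2]⟩

lemma IsHodgeAllocation.eq_of_null
    {Φ Ψ : (N : ℕ) → Game N → ℕ → Finset (Fin N) → ℝ}
    (hΦ : IsHodgeAllocation Φ) (hΨ : IsHodgeAllocation Ψ) {n : ℕ}
    (ih : ∀ v k, Φ n v k = Ψ n v k) (v : Game (n + 1)) (i : Fin (n + 1))
    (hnull : ∀ S, i ∉ S → v.1 (insert i S) = v.1 S) (j : Fin (n + 1))
    (S : Finset (Fin (n + 1))) : Φ (n + 1) v j S = Ψ (n + 1) v j S := by
  obtain ⟨-, -, -, -, hΦ, -, -⟩ := hΦ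
  obtain ⟨-, -, -, -, hΨ, -, -⟩ := hΨ
  obtain ⟨hΦi, hΦj⟩ := hΦ n v i hnull
  obtain ⟨hΨi, hΨj⟩ := hΨ n v i hnull
  by_cases hji : j = i
  · rw [hji, hΦi, hΨi]
  obtain ⟨j, rfl⟩ := Fin.exists_succAbove_eq hji
  obtain ⟨T, hT⟩ : ∃ T : Finset (Fin n), T.image i.succAbove = S.erase i := by
    refine ⟨univ.filter fun k => i.succAbove k ∈ S, ?_⟩
    ext k
    simp only [mem_image, mem_filter, mem_univ, true_and, mem_erase]
    constructor
    · rintro ⟨l, hl, rfl⟩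
      exact ⟨Fin.succAbove_ne i l, hl⟩
    · rintro ⟨hk, hkS⟩
      obtain ⟨l, rfl⟩ := Fin.exists_succAbove_eq hk
      exact ⟨l, hkS, rfl⟩
  have hΦT := hΦj j T
  have hΨT := hΨj j T
  rw [hT] at hΦT hΨT
  by_cases hi : i ∈ S
  · rw [insert_erase hi] at hΦT hΨT
    rw [hΦT.1, hΦT.2, hΨT.1, hΨT.2, ih]
  · rw [erase_eq_of_notMem hi] at hΦT hΨT
    rw [hΦT.2, hΨT.2, ih]

/-- Allocations agree on multiples of the unanimity game of the grand coalition. -/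
lemma IsHodgeAllocation.eq_of_support_univ
    {Φ Ψ : (N : ℕ) → Game N → ℕ → Finset (Fin N) → ℝ}
    (hΦ : IsHodgeAllocation Φ) (hΨ : IsHodgeAllocation Ψ) {N : ℕ} (v : Game N)
    (hv : ∀ S, S ≠ univ → v.1 S = 0) (j : Fin N) (S : Finset (Fin N)) :
    Φ N v j S = Ψ N v j S := by
  obtain ⟨hΦ0, -, hΦsum, hΦsymm, -, -, hΦrefl⟩ := hΦ
  obtain ⟨hΨ0, -, hΨsum, hΨsymm, -, -, hΨrefl⟩ := hΨ
  have hswap : ∀ i j, swapGame i j v = v := by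
    refine fun i j => Subtype.ext (funext fun T => ?_)
    change v.1 (T.image (Equiv.swap i j)) = v.1 T
    by_cases hT : T = univ
    · rw [hT, image_univ_equiv]
    · rw [hv T hT, hv]
      intro h
      apply hT
      rw [← card_eq_iff_eq_univ, ← card_image_of_injective T (Equiv.swap i j).injective, h,
        card_univ]
  refine sub_eq_zero.1 (symmetric_allocation_eq_zero
    (d := fun (i : Fin N) T => Φ N v i T - Ψ N v i T) ?_ ?_ ?_ j S)
  · intro T
    rw [sum_sub_distrib, ← hΦsum, ← hΨsum, sub_self]
  · intro i k T
    have h₁ := hΦsymm N v i k T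
    have h₂ := hΨsymm N v i k T
    rw [hswap] at h₁ h₂
    rw [h₁, h₂]
  · intro i T hi
    have h₁ := hΦrefl N v i T ∅ hi (notMem_empty i)
    have h₂ := hΨrefl N v i T ∅ hi (notMem_empty i)
    rw [hΦ0, insert_empty_eq] at h₁
    rw [hΨ0, insert_empty_eq] at h₂
    linarith

/-- Allocations that agree on games with `n` players agree on games with `n + 1` players whose
support consists of coalitions containing the complement of `A`. -/
lemma IsHodgeAllocation.eq_of_support
    {Φ Ψ : (N : ℕ) → Game N → ℕ → Finset (Fin N) → ℝ}
    (hΦ : IsHodgeAllocation Φ) (hΨ : IsHodgeAllocation Ψ) {n : ℕ}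
    (ih : ∀ v k, Φ n v k = Ψ n v k) (A : Finset (Fin (n + 1))) (v : Game (n + 1))
    (hv : ∀ S, ¬ Aᶜ ⊆ S → v.1 S = 0) (j : Fin (n + 1)) (S : Finset (Fin (n + 1))) :
    Φ (n + 1) v j S = Ψ (n + 1) v j S := by
  induction A using Finset.induction_on generalizing v with
  | empty =>
    refine hΦ.eq_of_support_univ hΨ v (fun T hT => hv T ?_) j S
    rwa [compl_empty, univ_subset_iff]
  | insert i A hi ihA =>
    have herase := hΦ.eq_of_null hΨ ih (eraseGame i v) i
      (fun T hT => by simp [eraseGame, hT]) j S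
    have hdiff := ihA (gameLC 1 (-1) v (eraseGame i v)) fun T hT => by
      change 1 * v.1 T + -1 * v.1 (T.erase i) = 0
      by_cases hiT : i ∈ T
      · have hT' : ¬ (insert i A)ᶜ ⊆ T := by
          intro h
          refine hT fun k hk => ?_
          by_cases hki : k = i
          · rwa [hki]
          · exact h (by simpa [hki] using hk)
        rw [hv T hT', hv _ fun h => hT' (h.trans (erase_subset i T))]
        ring
      · rw [erase_eq_of_notMem hiT]
        ring
    obtain ⟨-, -, -, -, -, hΦlin, -⟩ := hΦ
    obtain ⟨-, -, -, -, -, hΨlin, -⟩ := hΨ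
    rw [hΦlin, hΨlin] at hdiff
    linarith

/-- Uniqueness: any two allocations satisfying axioms A1--A5 coincide. -/
theorem hodge_allocation_unique
    (Φ Ψ : (N : ℕ) → Game N → ℕ → Finset (Fin N) → ℝ)
    (hΦ : IsHodgeAllocation Φ) (hΨ : IsHodgeAllocation Ψ) :
    ∀ (N : ℕ) (v : Game N) (i : ℕ), Φ N v i = Ψ N v i := by
  intro N
  induction N with
  | zero =>
    intro v i
    funext S
    rw [hΦ.2.1 0 v i i.zero_le S, hΨ.2.1 0 v i i.zero_le S]
  | succ n ih =>
    intro v i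
    funext S
    by_cases hi : i < n + 1
    · exact hΦ.eq_of_support hΨ ih univ v (fun T hT => by simp at hT) ⟨i, hi⟩ S
    · rw [hΦ.2.1 _ v i (not_lt.1 hi) S, hΨ.2.1 _ v i (not_lt.1 hi) S]
end

section
/- For every v ∈ 𝒢_N, the component games satisfy efficiency: ∑_{i∈[N]} v_i = v, i.e. ∑_{i∈[N]} v_i(S) = v(S) for every S ⊆ [N]. -/
open Finset

/-- The gradient `d`: `grad u S i = du(S, S ∪ {i}) = u(S ∪ {i}) − u(S)`.
An edge function `f` is represented by its values `f S i = f(S, S ∪ {i})`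
on the forward-oriented edges `(S, S ∪ {i})`, `i ∉ S`. -/
def grad {N : ℕ} (u : Finset (Fin N) → ℝ) : Finset (Fin N) → Fin N → ℝ :=
  fun S i => u (insert i S) - u S

/-- The partial differential operator `d_i`:
`d_i u (S, S ∪ {j}) = du(S, S ∪ {i})` if `j = i` and `0` otherwise. -/
def dPart {N : ℕ} (i : Fin N) (u : Finset (Fin N) → ℝ) : Finset (Fin N) → Fin N → ℝ :=
  fun S j => if j = i then u (insert i S) - u S else 0

/-- The adjoint `d*` (negative divergence): `(d* f)(S) = ∑_{T ∼ S} f(T, S)`,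
where the neighbors of `S` are `S \ {i}` (for `i ∈ S`) and `S ∪ {i}` (for `i ∉ S`),
and `f(b, a) = −f(a, b)` on reverse-oriented edges. -/
def dstar {N : ℕ} (f : Finset (Fin N) → Fin N → ℝ) : Finset (Fin N) → ℝ :=
  fun S => ∑ i : Fin N, if i ∈ S then f (S.erase i) i else -f S i

/-- `w` is the component game `v_i` of player `i` for the game `v`:
the unique solution of the least squares equation `d* d w = d* d_i v` with `w(∅) = 0`. -/
def IsComponentGame {N : ℕ} (v : Finset (Fin N) → ℝ) (i : Fin N)
    (w : Finset (Fin N) → ℝ) : Prop :=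
  w ∅ = 0 ∧ ∀ S : Finset (Fin N), dstar (grad w) S = dstar (dPart i v) S

theorem dstar_sum {N : ℕ} {ι : Type*} (s : Finset ι) (f : ι → Finset (Fin N) → Fin N → ℝ)
    (S : Finset (Fin N)) :
    dstar (fun T j => ∑ k ∈ s, f k T j) S = ∑ k ∈ s, dstar (f k) S := by
  simp only [dstar]
  rw [Finset.sum_comm]
  refine Finset.sum_congr rfl fun j _ => ?_
  split_ifs <;> simp

theorem dstar_sub {N : ℕ} (f g : Finset (Fin N) → Fin N → ℝ) (S : Finset (Fin N)) :
    dstar (fun T j => f T j - g T j) S = dstar f S - dstar g S := by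
  simp only [dstar, ← Finset.sum_sub_distrib]
  refine Finset.sum_congr rfl fun j _ => ?_
  split_ifs <;> ring

theorem grad_sub {N : ℕ} (u v : Finset (Fin N) → ℝ) :
    grad (fun S => u S - v S) = fun S j => grad u S j - grad v S j := by
  funext S j
  simp only [grad]
  ring

theorem grad_sum {N : ℕ} {ι : Type*} (s : Finset ι) (u : ι → Finset (Fin N) → ℝ) :
    grad (fun S => ∑ k ∈ s, u k S) = fun S j => ∑ k ∈ s, grad (u k) S j := by
  funext S j
  simp only [grad, Finset.sum_sub_distrib]

theorem sum_dPart {N : ℕ} (v : Finset (Fin N) → ℝ) :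
    (fun S j => ∑ i : Fin N, dPart i v S j) = grad v := by
  funext S j
  simp [dPart, grad]

/-- The value of the graph Laplacian `d* d u` at `S` is the sum of the differences
between `u S` and the values of `u` at the neighbors of `S`. -/
theorem dstar_grad_apply {N : ℕ} (u : Finset (Fin N) → ℝ) (S : Finset (Fin N)) :
    dstar (grad u) S =
      ∑ i : Fin N, if i ∈ S then u S - u (S.erase i) else u S - u (insert i S) := by
  refine Finset.sum_congr rfl fun i _ => ?_
  split_ifs with h
  · simp [grad, Finset.insert_erase h]
  · simp [grad]

/-- A harmonic function on the hypercube which is maximal at `S` takes the same value at `∅`. -/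
theorem eq_empty_of_harmonic_of_max {N : ℕ} {u : Finset (Fin N) → ℝ}
    (hu : ∀ S, dstar (grad u) S = 0) (S : Finset (Fin N)) (hS : ∀ T, u T ≤ u S) :
    u S = u ∅ := by
  induction S using Finset.induction_on with
  | empty => rfl
  | insert a S ha ih =>
    have hsum := hu (insert a S)
    rw [dstar_grad_apply, Finset.sum_eq_zero_iff_of_nonneg] at hsum
    · have h := hsum a (Finset.mem_univ a)
      rw [if_pos (Finset.mem_insert_self a S), Finset.erase_insert ha, sub_eq_zero] at h
      rw [h]
      exact ih fun T => h ▸ hS T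
    · intro i _
      split_ifs <;> exact sub_nonneg.2 (hS _)

theorem le_empty_of_harmonic {N : ℕ} {u : Finset (Fin N) → ℝ}
    (hu : ∀ S, dstar (grad u) S = 0) (S : Finset (Fin N)) : u S ≤ u ∅ := by
  obtain ⟨M, hM⟩ := Finite.exists_max u
  exact (hM S).trans (eq_empty_of_harmonic_of_max hu M hM).le

/-- The difference of two functions with the same Laplacian is maximal at `∅`. -/
theorem sub_le_sub_empty_of_dstar_grad_eq {N : ℕ} {u v : Finset (Fin N) → ℝ}
    (h : ∀ S, dstar (grad u) S = dstar (grad v) S) (S : Finset (Fin N)) :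
    u S - v S ≤ u ∅ - v ∅ :=
  le_empty_of_harmonic (u := fun S => u S - v S)
    (fun T => by rw [grad_sub, dstar_sub, h, sub_self]) S

/-- Efficiency of the component games: `∑_{i ∈ [N]} v_i = v`. -/
theorem componentGames_efficiency (N : ℕ) (v : Finset (Fin N) → ℝ) (hv : v ∅ = 0)
    (w : Fin N → Finset (Fin N) → ℝ)
    (hw : ∀ i : Fin N, IsComponentGame v i (w i)) :
    ∀ S : Finset (Fin N), ∑ i : Fin N, w i S = v S := by
  intro S
  have h : ∀ T, dstar (grad fun T => ∑ i : Fin N, w i T) T = dstar (grad v) T := by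
    intro T
    rw [grad_sum, dstar_sum, ← sum_dPart, dstar_sum]
    exact Finset.sum_congr rfl fun i _ => (hw i).2 T
  have h₀ : ∑ i : Fin N, w i ∅ = 0 := Finset.sum_eq_zero fun i _ => (hw i).1
  have h₁ := sub_le_sub_empty_of_dstar_grad_eq h S
  have h₂ := sub_le_sub_empty_of_dstar_grad_eq (fun T => (h T).symm) S
  simp only [h₀, hv] at h₁ h₂
  linarith
end

section
/- Let v ∈ 𝒢_N and i ∈ [N] with d_i v = 0, and let v_{−i} be the restriction of v to the player set [N]∖{i}. Then for every j ∈ [N]∖{i} and every S ⊆ [N]∖{i}, the component games satisfy v_j(S∪{i}) = v_j(S) = (v_{−i})_j(S), where (v_{−i})_j is the component game of player j for the restricted game v_{−i} computed on the hypercube graph over [N]∖{i}. -/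
open Finset

theorem dstar_grad_sub {N : ℕ} (u w : Finset (Fin N) → ℝ) (S : Finset (Fin N)) :
    dstar (grad (fun T => u T - w T)) S = dstar (grad u) S - dstar (grad w) S := by
  simp only [dstar, grad, ← Finset.sum_sub_distrib]
  refine Finset.sum_congr rfl fun i _ => ?_
  split_ifs <;> ring

/-- A function that is harmonic on the hypercube is constant (maximum principle). -/
theorem eq_of_dstar_grad_eq_zero {N : ℕ} {u : Finset (Fin N) → ℝ}
    (hu : ∀ S, dstar (grad u) S = 0) (S : Finset (Fin N)) : u S = u ∅ := by
  obtain ⟨M, hM⟩ := Finite.exists_max u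
  have key : ∀ T, u T = u M → ∀ i, (i ∈ T → u (T.erase i) = u M) ∧
      (i ∉ T → u (insert i T) = u M) := by
    intro T hT i
    have h0 := hu T
    unfold dstar at h0
    rw [Finset.sum_eq_zero_iff_of_nonneg] at h0
    · have hi := h0 i (Finset.mem_univ i)
      refine ⟨fun h => ?_, fun h => ?_⟩
      · rw [if_pos h, grad, Finset.insert_erase h] at hi
        linarith
      · rw [if_neg h, grad] at hi
        linarith
    · intro k _
      split_ifs with h
      · rw [grad, Finset.insert_erase h]
        linarith [hM (T.erase k)]
      · rw [grad]
        linarith [hM (insert k T)]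
  have down : ∀ T : Finset (Fin N), u T = u M → u ∅ = u M := by
    intro T
    induction T using Finset.induction_on with
    | empty => exact id
    | insert a s ha ih =>
      intro h
      have := (key _ h a).1 (Finset.mem_insert_self a s)
      rw [Finset.erase_insert ha] at this
      exact ih this
  have up : ∀ T : Finset (Fin N), u T = u M := by
    intro T
    induction T using Finset.induction_on with
    | empty => exact down M rfl
    | insert a s ha ih => exact (key s ih a).2 ha
  rw [up S, up ∅]

theorem IsComponentGame.unique {N : ℕ} {v : Finset (Fin N) → ℝ} {i : Fin N}
    {u w : Finset (Fin N) → ℝ} (hu : IsComponentGame v i u) (hw : IsComponentGame v i w) :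
    u = w := by
  funext S
  have h := eq_of_dstar_grad_eq_zero (u := fun T => u T - w T)
    (fun T => by rw [dstar_grad_sub, hu.2, hw.2, sub_self]) S
  simp only [hu.1, hw.1] at h
  linarith

/-- The coalition `S \ {i}`, viewed in the player set without `i`. -/
def dropPlayer {n : ℕ} (i : Fin (n + 1)) (S : Finset (Fin (n + 1))) : Finset (Fin n) :=
  Finset.univ.filter fun k => i.succAbove k ∈ S

section dropPlayer

variable {n : ℕ} (i : Fin (n + 1))

theorem mem_dropPlayer {S : Finset (Fin (n + 1))} {k : Fin n} :
    k ∈ dropPlayer i S ↔ i.succAbove k ∈ S := by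
  simp [dropPlayer]

theorem dropPlayer_insert_self (S : Finset (Fin (n + 1))) :
    dropPlayer i (insert i S) = dropPlayer i S := by
  ext k
  simp [mem_dropPlayer, Fin.succAbove_ne]

theorem dropPlayer_erase_self (S : Finset (Fin (n + 1))) :
    dropPlayer i (S.erase i) = dropPlayer i S := by
  ext k
  simp [mem_dropPlayer, Fin.succAbove_ne]

theorem dropPlayer_insert_succAbove (S : Finset (Fin (n + 1))) (k : Fin n) :
    dropPlayer i (insert (i.succAbove k) S) = insert k (dropPlayer i S) := by
  ext l
  simp [mem_dropPlayer]

theorem dropPlayer_erase_succAbove (S : Finset (Fin (n + 1))) (k : Fin n) :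
    dropPlayer i (S.erase (i.succAbove k)) = (dropPlayer i S).erase k := by
  ext l
  simp [mem_dropPlayer]

theorem dropPlayer_image_succAbove (S : Finset (Fin n)) :
    dropPlayer i (S.image i.succAbove) = S := by
  ext l
  simp [mem_dropPlayer]

theorem image_dropPlayer (S : Finset (Fin (n + 1))) :
    (dropPlayer i S).image i.succAbove = S.erase i := by
  ext l
  rcases Fin.eq_self_or_eq_succAbove i l with rfl | ⟨k, rfl⟩
  · simp [Fin.succAbove_ne]
  · simp [mem_dropPlayer, Fin.succAbove_ne]

/-- The component game of a restricted game, extended so that `i` is a null player, is the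
component game of the extended game. -/
theorem IsComponentGame.comp_dropPlayer {w : Finset (Fin n) → ℝ} {v : Finset (Fin n) → ℝ}
    {j : Fin n} (hw : IsComponentGame v j w) :
    IsComponentGame (fun S => v (dropPlayer i S)) (i.succAbove j)
      (fun S => w (dropPlayer i S)) := by
  refine ⟨by simpa [dropPlayer] using hw.1, fun S => ?_⟩
  have h := hw.2 (dropPlayer i S)
  simp only [dstar, grad, dPart, mem_dropPlayer] at h
  simp only [dstar, grad, dPart, Fin.sum_univ_succAbove _ i, dropPlayer_insert_self,
    dropPlayer_erase_self, dropPlayer_insert_succAbove, dropPlayer_erase_succAbove,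
    Fin.succAbove_right_inj, (Fin.succAbove_ne i j).symm, sub_self, neg_zero, ite_self,
    if_false, zero_add]
  exact h

end dropPlayer

/-- Null-player restriction property: if `d_i v = 0` then for every other player `j`
and every `S ⊆ [N] \ {i}`, the component games satisfy
`v_j(S ∪ {i}) = v_j(S) = (v_{-i})_j(S)`, where `v_{-i}` is the restriction of `v`
to the player set `[N] \ {i}`, identified with `Fin n` (where `N = n+1`) via the
order-preserving bijection `Fin.succAbove i`. -/
theorem componentGame_null_player_restriction (n : ℕ)
    (v : Finset (Fin (n + 1)) → ℝ) (hv : v ∅ = 0) (i : Fin (n + 1))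
    (hdi : ∀ S : Finset (Fin (n + 1)), i ∉ S → v (insert i S) = v S)
    (j : Fin n)
    (vj : Finset (Fin (n + 1)) → ℝ) (hvj : IsComponentGame v (i.succAbove j) vj)
    (wj : Finset (Fin n) → ℝ)
    (hwj : IsComponentGame (fun S : Finset (Fin n) => v (S.image i.succAbove)) j wj) :
    ∀ S : Finset (Fin n),
      vj (insert i (S.image i.succAbove)) = vj (S.image i.succAbove) ∧
      vj (S.image i.succAbove) = wj S := by
  have hv_drop : (fun S => v ((dropPlayer i S).image i.succAbove)) = v := by
    funext S
    rw [image_dropPlayer]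
    by_cases hS : i ∈ S
    · rw [← hdi _ (Finset.notMem_erase i S), Finset.insert_erase hS]
    · rw [Finset.erase_eq_of_notMem hS]
  have hw := hwj.comp_dropPlayer i
  rw [hv_drop] at hw
  obtain rfl := hvj.unique hw
  intro S
  simp only [dropPlayer_insert_self, dropPlayer_image_succAbove, and_self]
end
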